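/- arXiv:1809.05553 — 2 statements merged into one kernel-verified Lean document; each statement's English description precedes it below -/
import Mathlib

section
/- Let f : ℂ² → ℂ be an entire function such that f(z₁, z₂) ≠ 0 for all (z₁, z₂) ∈ ℂ² and ∂f/∂z₁(z₁, z₂) + ∂f/∂z₂(z₁, z₂) ≠ 1 for all (z₁, z₂) ∈ ℂ². Then there is an entire function h : ℂ → ℂ such that f(z₁, z₂) = exp(h(z₁ − z₂)) for all (z₁, z₂) ∈ ℂ². -/
open Complex Metric Set Filter Topology

/-- Upper Harnack-type bound for holomorphic functions with positive real part on a ball. -/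
theorem norm_le_of_re_pos_on_ball {Q : ℂ → ℂ} {c z : ℂ} {R : ℝ}
    (hQ : DifferentiableOn ℂ Q (ball c R)) (hpos : ∀ w ∈ ball c R, 0 < (Q w).re)
    (hz : z ∈ ball c R) :
    ‖Q z‖ ≤ ‖Q c‖ * ((R + dist z c) / (R - dist z c)) := by
  have hzR : dist z c < R := hz
  have hR : 0 < R := dist_nonneg.trans_lt hzR
  have hmaps : MapsTo (fun w : ℂ => c + w) (ball 0 R) (ball c R) := fun w hw => by
    simpa [dist_eq_norm] using hw
  have key : ∀ M : ℝ, 0 < M → ‖Q z‖ ≤ 2 * M * dist z c / (R - dist z c) +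
      ‖Q c‖ * (R + dist z c) / (R - dist z c) := by
    intro M hM
    have := Complex.borelCaratheodory (f := fun w => -Q (c + w)) (M := M) (R := R) (z := z - c) hM
      (hQ.comp (by fun_prop) hmaps).neg
      (fun w hw => by
        have := hpos _ (hmaps hw)
        simp only [mem_ofPred_eq, neg_re]
        linarith) hR (by simpa [dist_eq_norm] using hz)
    simpa [dist_eq_norm] using this
  have hlim : Tendsto (fun M : ℝ => 2 * M * dist z c / (R - dist z c) +
      ‖Q c‖ * (R + dist z c) / (R - dist z c)) (𝓝[>] 0)
      (𝓝 (2 * 0 * dist z c / (R - dist z c) + ‖Q c‖ * (R + dist z c) / (R - dist z c))) :=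
    (Continuous.tendsto (by fun_prop) 0).mono_left nhdsWithin_le_nhds
  have := ge_of_tendsto hlim (eventually_mem_nhdsWithin.mono key)
  simpa [mul_div_assoc] using this

/-- Lower Harnack-type bound for holomorphic functions with positive real part on a ball. -/
theorem norm_center_le_of_re_pos_on_ball {Q : ℂ → ℂ} {c z : ℂ} {R : ℝ}
    (hQ : DifferentiableOn ℂ Q (ball c R)) (hpos : ∀ w ∈ ball c R, 0 < (Q w).re)
    (hz : z ∈ ball c R) :
    ‖Q c‖ ≤ ‖Q z‖ * ((R + dist z c) / (R - dist z c)) := by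
  have hzR : dist z c < R := hz
  have hne : ∀ w ∈ ball c R, Q w ≠ 0 := fun w hw h => by
    simpa [h] using hpos w hw
  have hc : c ∈ ball c R := mem_ball_self (dist_nonneg.trans_lt hzR)
  have h := norm_le_of_re_pos_on_ball (Q := fun w => (Q w)⁻¹) (hQ.inv hne)
    (fun w hw => by
      rw [inv_re]
      exact div_pos (hpos w hw) (normSq_pos.2 (hne w hw))) hz
  simp only [norm_inv] at h
  have h1 : 0 < ‖Q z‖ := norm_pos_iff.2 (hne z hz)
  have h2 : 0 < ‖Q c‖ := norm_pos_iff.2 (hne c hc)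
  rw [inv_mul_eq_div, inv_eq_one_div, div_le_div_iff₀ h1 h2] at h
  linarith

/-- A boundary derivative estimate of Hopf type. -/
theorem norm_center_le_two_mul_radius_mul_norm_deriv {Q : ℂ → ℂ} {c x : ℂ}
    (hQ : Differentiable ℂ Q) (hpos : ∀ w ∈ ball c (dist x c), 0 < (Q w).re)
    (hx : x ≠ c) (hQx : Q x = 0) :
    ‖Q c‖ ≤ 2 * dist x c * ‖deriv Q x‖ := by
  have hd : 0 < dist x c := dist_pos.2 hx
  have hline : HasDerivAt (fun t : ℝ => Q (x + t * (c - x))) (deriv Q x * (c - x)) 0 := by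
    have h1 : HasDerivAt (fun t : ℝ => x + (t : ℂ) * (c - x)) (c - x) 0 := by
      simpa using (((hasDerivAt_id (0 : ℝ)).ofReal_comp).mul_const (c - x)).const_add x
    have h2 : HasDerivAt Q (deriv Q x) (x + ((0 : ℝ) : ℂ) * (c - x)) := by
      simpa using (hQ x).hasDerivAt
    exact h2.comp (0 : ℝ) h1
  have hlim := hline.tendsto_slope_zero_right.norm.const_mul 2
  rw [norm_mul, ← dist_eq_norm c x, dist_comm c x] at hlim
  have : 2 * dist x c * ‖deriv Q x‖ = 2 * (‖deriv Q x‖ * dist x c) := by ring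
  rw [this]
  refine ge_of_tendsto hlim ?_
  filter_upwards [Ioo_mem_nhdsGT (zero_lt_one' ℝ)] with t ht
  have hdist : dist (x + t * (c - x)) c = (1 - t) * dist x c := by
    have h1 : x + t * (c - x) - c = ((1 - t : ℝ) : ℂ) * (x - c) := by push_cast; ring
    rw [dist_eq_norm, h1, norm_mul, norm_real, Real.norm_of_nonneg (by linarith [ht.2]),
      dist_eq_norm]
  have hmem : x + t * (c - x) ∈ ball c (dist x c) := by
    rw [mem_ball, hdist]
    nlinarith [ht.1]
  have h := norm_center_le_of_re_pos_on_ball hQ.differentiableOn hpos hmem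
  rw [hdist] at h
  have ht0 := ht.1
  have hfrac : (dist x c + (1 - t) * dist x c) / (dist x c - (1 - t) * dist x c) ≤ 2 / t := by
    have : dist x c - (1 - t) * dist x c = t * dist x c := by ring
    rw [this, div_le_div_iff₀ (by positivity) ht0]
    nlinarith [mul_pos (mul_pos ht0 ht0) hd]
  simp only [zero_add, ofReal_zero, zero_mul, add_zero, hQx, sub_zero, norm_smul, norm_inv,
    Real.norm_of_nonneg ht0.le]
  calc ‖Q c‖ ≤ _ := h
    _ ≤ ‖Q (x + t * (c - x))‖ * (2 / t) := by gcongr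
    _ = _ := by ring

/-- Linear growth of `Re P` when `|(exp P)'| ≤ 1` wherever `|exp P| ≤ 1/2`. -/
theorem re_le_linear_of_norm_deriv_exp_le {P : ℂ → ℂ} {r : ℝ} (hP : Differentiable ℂ P)
    (hP0 : P 0 = 0)
    (hb : ∀ z, ‖z‖ ≤ 4 * r → ‖exp (P z)‖ ≤ 1 / 2 → ‖deriv P z * exp (P z)‖ ≤ 1)
    {z : ℂ} (hz : ‖z‖ ≤ r) : (P z).re ≤ 12 * ‖z‖ + 3 := by
  have hPc := hP.continuous
  have hlog2 : 0 < Real.log 2 := Real.log_pos one_lt_two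
  have hlog2' : Real.log 2 < 1 := Real.log_two_lt_d9.trans (by norm_num)
  rcases eq_or_ne z 0 with rfl | hz0
  · simp [hP0]
  have hzp : 0 < ‖z‖ := norm_pos_iff.2 hz0
  by_cases hcase : ∀ w ∈ ball (0 : ℂ) (2 * ‖z‖), 0 < (P w + (Real.log 2 : ℝ)).re
  · have h := norm_le_of_re_pos_on_ball (Q := fun w => P w + (Real.log 2 : ℝ)) (z := z)
      (by fun_prop) hcase (by simp; linarith)
    simp only [hP0, zero_add, dist_zero_right, norm_real, Real.norm_of_nonneg hlog2.le] at h
    have h3 : (2 * ‖z‖ + ‖z‖) / (2 * ‖z‖ - ‖z‖) = 3 := by field_simp; ring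
    rw [h3] at h
    have := (re_le_norm _).trans h
    simp only [add_re, ofReal_re] at this
    linarith
  · push Not at hcase
    obtain ⟨w, hw, hwP⟩ := hcase
    simp only [add_re, ofReal_re] at hwP
    rw [mem_ball_zero_iff] at hw
    set E : Set ℂ := {w | (P w).re ≤ -Real.log 2} with hE
    have hEc : IsClosed E := isClosed_le (by fun_prop) continuous_const
    have hwE : w ∈ E := by simp only [hE, mem_ofPred_eq]; linarith
    by_cases hzE : z ∈ E
    · simp only [hE, mem_ofPred_eq] at hzE
      linarith
    obtain ⟨x, hxE, hx⟩ := hEc.exists_infDist_eq_dist ⟨w, hwE⟩ z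
    have hd3 : dist x z ≤ 3 * ‖z‖ := by
      rw [dist_comm, ← hx]
      refine (infDist_le_dist_of_mem hwE).trans ?_
      rw [dist_eq_norm]
      linarith [norm_sub_le z w]
    have hx4 : ‖x‖ ≤ 4 * ‖z‖ := by
      have := norm_add_le (x - z) z
      rw [sub_add_cancel, ← dist_eq_norm] at this
      linarith
    have hball : ∀ y ∈ ball z (dist x z), -Real.log 2 < (P y).re := fun y hy => by
      by_contra! hyE
      have h1 := infDist_le_dist_of_mem (x := z) (show y ∈ E from hyE)
      rw [mem_ball, dist_comm y, dist_comm x] at hy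
      linarith
    have hxz : x ≠ z := fun h => hzE (h ▸ hxE)
    have hxre : (P x).re = -Real.log 2 := by
      refine le_antisymm hxE ?_
      have hcl : x ∈ closure (ball z (dist x z)) := by
        rw [closure_ball _ (dist_pos.2 hxz).ne']
        simp
      have hsub : closure (ball z (dist x z)) ⊆ {y | -Real.log 2 ≤ (P y).re} :=
        closure_minimal (fun y hy => (hball y hy).le)
          (isClosed_le continuous_const (by fun_prop))
      exact hsub hcl
    have hnorm : ‖exp (P x)‖ = 1 / 2 := by
      rw [norm_exp, hxre, Real.exp_neg, Real.exp_log two_pos]; norm_num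
    have hder : ‖deriv P x‖ ≤ 2 := by
      have := hb x (by linarith) hnorm.le
      rw [norm_mul, hnorm] at this
      linarith
    have h := norm_center_le_two_mul_radius_mul_norm_deriv (Q := fun y => P y - P x) (c := z)
      (x := x) (by fun_prop) (fun y hy => by
        have := hball y hy
        rw [sub_re, hxre]; linarith) hxz (sub_self _)
    rw [deriv_sub_const] at h
    have h2 := (re_le_norm _).trans h
    rw [sub_re, hxre] at h2
    nlinarith [dist_nonneg (x := x) (y := z)]

/-- Quantitative Hurwitz-type statement for functions close to `exp` on a small disc. -/
theorem exists_eq_one_of_norm_sub_exp_le {H : ℂ → ℂ} (hH : Differentiable ℂ H)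
    (h : ∀ u, ‖u‖ ≤ 1 / 2 → ‖H u - exp u‖ ≤ 1 / 20) : ∃ u, H u = 1 := by
  by_contra! hne
  have hne' : ∀ u, H u - 1 ≠ 0 := fun u => sub_ne_zero.2 (hne u)
  have hd : Differentiable ℂ fun u => (H u - 1)⁻¹ := (hH.sub_const 1).inv hne'
  have hbd : ∀ u ∈ frontier (ball (0 : ℂ) (1 / 2)), ‖(H u - 1)⁻¹‖ ≤ 5 := by
    intro u hu
    rw [frontier_ball _ (by norm_num), mem_sphere_zero_iff_norm] at hu
    have h1 := Complex.norm_exp_sub_one_sub_id_le (x := u) (by rw [hu]; norm_num)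
    have h2 := h u hu.le
    have h3 : u = (H u - 1) - (H u - exp u) - (exp u - 1 - u) := by ring
    have h4 : ‖u‖ ≤ ‖H u - 1‖ + ‖H u - exp u‖ + ‖exp u - 1 - u‖ := by
      conv_lhs => rw [h3]
      exact (norm_sub_le _ _).trans (by gcongr; exact norm_sub_le _ _)
    rw [hu] at h1 h4
    rw [norm_inv]
    refine inv_le_of_inv_le₀ (by norm_num) ?_
    norm_num at h1 h2 ⊢
    linarith
  have h0 := norm_le_of_forall_mem_frontier_norm_le isBounded_ball hd.diffContOnCl hbd
    (subset_closure (mem_ball_self (by norm_num : (0 : ℝ) < 1 / 2)))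
  have h1 := h 0 (by norm_num)
  rw [exp_zero] at h1
  rw [norm_inv] at h0
  have h2 := inv_le_of_inv_le₀ (norm_pos_iff.2 (hne' 0)) h0
  norm_num at h1 h2
  linarith

/-- If `Re P` grows at most linearly on a huge disc and `|P'(0)| ≥ 1`, then `(exp P)'` takes the
value `1`. -/
theorem exists_deriv_mul_exp_eq_one {P : ℂ → ℂ} (hP : Differentiable ℂ P) (hP0 : P 0 = 0)
    (ha1 : 1 ≤ ‖deriv P 0‖)
    (hre : ∀ z, ‖z‖ ≤ 10 ^ 10 → (P z).re ≤ 12 * ‖z‖ + 3) :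
    ∃ z, deriv P z * exp (P z) = 1 := by
  set a := deriv P 0 with ha
  have ha0 : a ≠ 0 := norm_pos_iff.1 (by linarith)
  have hgrowth : ∀ z, 2 * ‖z‖ ≤ 10 ^ 10 → ‖P z‖ ≤ 48 * ‖z‖ + 6 := by
    intro z hz
    rcases eq_or_ne z 0 with rfl | hz0
    · simp [hP0]
    have hzp : 0 < ‖z‖ := norm_pos_iff.2 hz0
    have := borelCaratheodory_zero (f := P) (M := 24 * ‖z‖ + 3) (R := 2 * ‖z‖) (z := z)
      (by positivity) hP.differentiableOn (fun w hw => by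
        rw [mem_ball_zero_iff] at hw
        have := hre w (by linarith)
        simp only [mem_ofPred_eq]
        linarith) (by positivity) (by rw [mem_ball_zero_iff]; linarith) hP0
    have h2 : 2 * (24 * ‖z‖ + 3) * ‖z‖ / (2 * ‖z‖ - ‖z‖) = 48 * ‖z‖ + 6 := by
      field_simp; ring
    rwa [h2] at this
  have ha54 : ‖a‖ ≤ 54 := by
    have := norm_deriv_le_of_forall_mem_sphere_norm_le (c := 0) (R := 1) (C := 54) one_pos
      hP.diffContOnCl (fun z hz => by
        rw [mem_sphere_zero_iff_norm] at hz
        have := hgrowth z (by rw [hz]; norm_num)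
        rw [hz] at this
        linarith)
    simpa using this
  have hP' : Differentiable ℂ (deriv P) := hP.deriv
  have hsecond : ∀ z ∈ closedBall (0 : ℂ) 100, ‖deriv (deriv P) z‖ ≤ 1 / 10 ^ 7 := by
    intro z hz
    rw [mem_closedBall_zero_iff] at hz
    have := norm_iteratedDeriv_le_of_forall_mem_sphere_norm_le (c := z) (R := 10 ^ 9)
      (C := 49 * 10 ^ 9) (f := P) 2 (by norm_num) hP.diffContOnCl (fun w hw => by
        rw [mem_sphere_iff_norm] at hw
        have h1 : ‖w‖ ≤ 10 ^ 9 + 100 := by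
          have := norm_add_le (w - z) z
          rw [sub_add_cancel] at this
          linarith
        have := hgrowth w (by linarith)
        linarith)
    rw [iteratedDeriv_succ, iteratedDeriv_one] at this
    refine this.trans ?_
    norm_num [Nat.factorial]
  have h0mem : (0 : ℂ) ∈ closedBall (0 : ℂ) 100 := mem_closedBall_self (by norm_num)
  have hfirst : ∀ z ∈ closedBall (0 : ℂ) 100, ‖deriv P z - a‖ ≤ 1 / 10 ^ 5 := by
    intro z hz
    have h1 := (convex_closedBall (0 : ℂ) 100).norm_image_sub_le_of_norm_deriv_le
      (fun w _ => hP' w) hsecond h0mem hz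
    rw [mem_closedBall_zero_iff] at hz
    rw [sub_zero] at h1
    linarith
  have hzeroth : ∀ z ∈ closedBall (0 : ℂ) 100, ‖P z - a * z‖ ≤ 1 / 10 ^ 3 := by
    intro z hz
    have h1 := (convex_closedBall (0 : ℂ) 100).norm_image_sub_le_of_norm_deriv_le
      (f := fun w => P w - a * w) (C := 1 / 10 ^ 5) (fun w _ => by fun_prop)
      (fun w hw => by
        have : HasDerivAt (fun w => P w - a * w) (deriv P w - a * 1) w :=
          (hP w).hasDerivAt.sub ((hasDerivAt_id w).const_mul a)
        rw [this.deriv, mul_one]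
        exact hfirst w hw) h0mem hz
    rw [mem_closedBall_zero_iff] at hz
    simp only [hP0, mul_zero, sub_zero] at h1
    linarith
  have hlog : ‖log a‖ ≤ 60 := by
    refine (norm_le_abs_re_add_abs_im _).trans ?_
    rw [log_re, log_im]
    have h1 : |Real.log ‖a‖| ≤ 53 := by
      rw [abs_of_nonneg (Real.log_nonneg ha1)]
      linarith [Real.log_le_sub_one_of_pos (by linarith : 0 < ‖a‖)]
    linarith [abs_arg_le_pi a, Real.pi_le_four]
  set φ : ℂ → ℂ := fun u => (u - log a) / a with hφ
  have hφd : Differentiable ℂ φ := by fun_prop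
  obtain ⟨u, hu⟩ := exists_eq_one_of_norm_sub_exp_le
    (H := fun u => deriv P (φ u) * exp (P (φ u))) (by fun_prop) (fun u hu => by
      have hmem : φ u ∈ closedBall (0 : ℂ) 100 := by
        rw [mem_closedBall_zero_iff, norm_div]
        refine (div_le_self (norm_nonneg _) ha1).trans ?_
        linarith [norm_sub_le u (log a)]
      have h1 := hfirst _ hmem
      have h2 := hzeroth _ hmem
      have haφ : a * φ u = u - log a := by simp only [hφ]; field_simp
      have hexp : exp (P (φ u)) = exp u / a * exp (P (φ u) - a * φ u) := by
        have : P (φ u) = (u - log a) + (P (φ u) - a * φ u) := by rw [haφ]; ring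
        conv_lhs => rw [this]
        rw [exp_add, exp_sub, exp_log ha0]
      set y := P (φ u) - a * φ u
      set x := deriv P (φ u) - a with hx
      have hE : ‖exp y - 1‖ ≤ 1 / 500 := by
        have := norm_exp_sub_one_le (x := y) (by linarith)
        linarith
      have hE2 : ‖exp y‖ ≤ 2 := by
        have := norm_add_le (exp y - 1) 1
        rw [sub_add_cancel, norm_one] at this
        linarith
      have hU : ‖exp u‖ ≤ 3 := by
        rw [norm_exp]
        have : u.re ≤ 1 := (re_le_norm u).trans (by linarith)
        exact (Real.exp_le_exp.2 this).trans (by linarith [Real.exp_one_lt_d9])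
      have hxa : ‖x / a‖ ≤ 1 / 10 ^ 5 := by
        rw [norm_div]
        exact (div_le_self (norm_nonneg _) ha1).trans h1
      have hdiff : deriv P (φ u) * exp (P (φ u)) - exp u =
          exp u * ((exp y - 1) + x / a * exp y) := by
        rw [hexp, show deriv P (φ u) = a + x by rw [hx]; ring]
        field_simp
        ring
      rw [hdiff, norm_mul]
      have h3 : ‖(exp y - 1) + x / a * exp y‖ ≤ 1 / 500 + 1 / 10 ^ 5 * 2 := by
        refine (norm_add_le _ _).trans ?_
        rw [norm_mul]
        gcongr
      calc ‖exp u‖ * ‖(exp y - 1) + x / a * exp y‖ ≤ 3 * (1 / 500 + 1 / 10 ^ 5 * 2) := by gcongr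
        _ ≤ 1 / 20 := by norm_num)
  exact ⟨φ u, hu⟩

/-- A zero-free entire function has an entire logarithm. -/
theorem exists_entire_log {f : ℂ → ℂ} (hf : Differentiable ℂ f) (h0 : ∀ z, f z ≠ 0) :
    ∃ p : ℂ → ℂ, Differentiable ℂ p ∧ ∀ z, f z = exp (p z) := by
  have hd : Differentiable ℂ fun z => deriv f z / f z := hf.deriv.div hf h0
  obtain ⟨p, hp0, hp⟩ := hd.isExactOn_univ.with_val_at 0 (log (f 0))
  have hpd : Differentiable ℂ p := fun z => (hp z (mem_univ z)).differentiableAt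
  refine ⟨p, hpd, fun z => ?_⟩
  have hq : ∀ w, HasDerivAt (fun w => f w * exp (-p w)) 0 w := fun w => by
    have h1 := (hf w).hasDerivAt.mul (hp w (mem_univ w)).neg.cexp
    refine h1.congr_deriv ?_
    field_simp [h0 w]
    ring
  have hconst := is_const_of_deriv_eq_zero (fun w => (hq w).differentiableAt)
    (fun w => (hq w).deriv) z 0
  simp only [hp0, exp_neg, exp_log (h0 0)] at hconst
  rw [mul_inv_cancel₀ (h0 0)] at hconst
  exact (mul_inv_eq_one₀ (exp_ne_zero _)).1 hconst

/-- A zero-free entire function whose derivative omits `1` has derivative of norm `< 1`. -/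
theorem norm_deriv_lt_one_of_omits {f : ℂ → ℂ} (hf : Differentiable ℂ f) (h0 : ∀ z, f z ≠ 0)
    (h1 : ∀ z, deriv f z ≠ 1) (z : ℂ) : ‖deriv f z‖ < 1 := by
  by_contra! hz
  obtain ⟨p, hp, hfp⟩ := exists_entire_log hf h0
  have hfc := hf.continuous
  have hf'c : Continuous (deriv f) := hf.deriv.continuous
  have hfz : 0 < ‖f z‖ := norm_pos_iff.2 (h0 z)
  set R : ℝ := ‖z‖ + 10 ^ 11 * ‖f z‖ with hR
  set A : Set ℂ := closedBall 0 R ∩ {w | 1 ≤ ‖deriv f w‖} with hA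
  have hAc : IsCompact A :=
    (isCompact_closedBall 0 R).inter_right (isClosed_le continuous_const hf'c.norm)
  have hzA : z ∈ A := ⟨by rw [mem_closedBall_zero_iff, hR]; linarith, hz⟩
  obtain ⟨z₀, hz₀A, hmax⟩ := hAc.exists_isMaxOn (f := fun w => (R - ‖w‖) / ‖f w‖) ⟨z, hzA⟩
    (((continuous_const.sub continuous_norm).div hfc.norm
      fun w => norm_ne_zero_iff.2 (h0 w)).continuousOn)
  have hfz₀ : 0 < ‖f z₀‖ := norm_pos_iff.2 (h0 z₀)
  set κ := (R - ‖z₀‖) / ‖f z₀‖ with hκ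
  have hκz₀ : R - ‖z₀‖ = κ * ‖f z₀‖ := by rw [hκ]; field_simp
  have hκbig : 10 ^ 11 ≤ κ := by
    have h2 : (R - ‖z‖) / ‖f z‖ ≤ κ := hmax hzA
    rwa [hR, add_sub_cancel_left, mul_div_cancel_right₀ _ hfz.ne'] at h2
  have hκA : ∀ w, 1 ≤ ‖deriv f w‖ → R - ‖w‖ ≤ κ * ‖f w‖ := fun w hw => by
    have hfw : 0 < ‖f w‖ := norm_pos_iff.2 (h0 w)
    by_cases hwR : ‖w‖ ≤ R
    · have h2 : (R - ‖w‖) / ‖f w‖ ≤ κ := hmax ⟨mem_closedBall_zero_iff.2 hwR, hw⟩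
      rwa [div_le_iff₀ hfw] at h2
    · have : 0 ≤ κ * ‖f w‖ := mul_nonneg (by linarith) hfw.le
      linarith
  set P : ℂ → ℂ := fun w => p (z₀ + f z₀ * w) - p z₀ with hP
  have hPd : Differentiable ℂ P := by fun_prop
  have hexpP : ∀ w, exp (P w) = f (z₀ + f z₀ * w) / f z₀ := fun w => by
    rw [hP, exp_sub, ← hfp, ← hfp]
  have hderiv : ∀ w, deriv P w * exp (P w) = deriv f (z₀ + f z₀ * w) := fun w => by
    have hlin : HasDerivAt (fun w => z₀ + f z₀ * w) (f z₀) w := by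
      simpa using ((hasDerivAt_id w).const_mul (f z₀)).const_add z₀
    have h2 : HasDerivAt (fun w => f (z₀ + f z₀ * w)) (deriv f (z₀ + f z₀ * w) * f z₀) w :=
      (hf _).hasDerivAt.comp w hlin
    have h3 : (fun w => exp (P w)) = fun w => f (z₀ + f z₀ * w) / f z₀ := funext hexpP
    have h4 := (hPd w).hasDerivAt.cexp
    rw [h3] at h4
    rw [mul_comm, h4.unique (h2.div_const (f z₀)), mul_div_cancel_right₀ _ (h0 z₀)]
  have hP0 : P 0 = 0 := by simp [hP]
  have ha1 : 1 ≤ ‖deriv P 0‖ := by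
    have := hderiv 0
    rw [hP0, exp_zero, mul_one, mul_zero, add_zero] at this
    rw [this]
    exact hz₀A.2
  have hb : ∀ w, ‖w‖ ≤ 4 * 10 ^ 10 → ‖exp (P w)‖ ≤ 1 / 2 → ‖deriv P w * exp (P w)‖ ≤ 1 := by
    intro w hw hwP
    rw [hderiv]
    by_contra! hlt
    have h2 := hκA _ hlt.le
    rw [hexpP, norm_div, div_le_iff₀ hfz₀] at hwP
    have h3 : ‖z₀ + f z₀ * w‖ ≤ ‖z₀‖ + ‖f z₀‖ * ‖w‖ :=
      (norm_add_le _ _).trans (by rw [norm_mul])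
    have h4 : κ * ‖f (z₀ + f z₀ * w)‖ ≤ κ * (1 / 2 * ‖f z₀‖) := by gcongr
    have h5 : κ / 2 * ‖f z₀‖ ≤ ‖w‖ * ‖f z₀‖ := by linarith
    have := le_of_mul_le_mul_right h5 hfz₀
    linarith
  obtain ⟨w, hw⟩ := exists_deriv_mul_exp_eq_one hPd hP0 ha1
    (fun w hw => re_le_linear_of_norm_deriv_exp_le hPd hP0 hb hw)
  exact h1 _ ((hderiv w).symm.trans hw)

/-- A zero-free entire function whose derivative omits `1` is constant. -/
theorem apply_eq_apply_of_omits {f : ℂ → ℂ} (hf : Differentiable ℂ f) (h0 : ∀ z, f z ≠ 0)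
    (h1 : ∀ z, deriv f z ≠ 1) (z w : ℂ) : f z = f w := by
  have hlt := norm_deriv_lt_one_of_omits hf h0 h1
  obtain ⟨c, hc⟩ := hf.deriv.exists_const_forall_eq_of_bounded
    (isBounded_iff_forall_norm_le.2 ⟨1, by rintro _ ⟨w, rfl⟩; exact (hlt w).le⟩)
  have hlin : ∀ z, f z - c * z = f 0 := fun z => by
    have hd : ∀ w, HasDerivAt (fun w => f w - c * w) 0 w := fun w => by
      refine ((hf w).hasDerivAt.sub ((hasDerivAt_id w).const_mul c)).congr_deriv ?_
      rw [hc, mul_one, sub_self]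
    simpa using is_const_of_deriv_eq_zero (fun w => (hd w).differentiableAt)
      (fun w => (hd w).deriv) z 0
  have hc0 : c = 0 := by
    by_contra hcne
    have h2 := hlin (-f 0 / c)
    rw [mul_div_cancel₀ _ hcne, sub_neg_eq_add, add_eq_right] at h2
    exact h0 _ h2
  have hz := hlin z
  have hw := hlin w
  simp only [hc0, zero_mul, sub_zero] at hz hw
  rw [hz, hw]

/-- Example (iii): if `f` is entire on `ℂ²`, omits `0`, and `f_{z₁} + f_{z₂}`
omits `1`, then `f(z₁, z₂) = exp(h(z₁ - z₂))` for some entire `h : ℂ → ℂ`. -/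
theorem exp_form_of_omits (f : ℂ × ℂ → ℂ) (hf : Differentiable ℂ f)
    (h0 : ∀ z : ℂ × ℂ, f z ≠ 0)
    (h1 : ∀ z : ℂ × ℂ,
      fderiv ℂ f z (1, 0) + fderiv ℂ f z (0, 1) ≠ 1) :
    ∃ h : ℂ → ℂ, Differentiable ℂ h ∧
      ∀ z₁ z₂ : ℂ, f (z₁, z₂) = Complex.exp (h (z₁ - z₂)) := by
  have hconst : ∀ c t : ℂ, f (c + t, t) = f (c, 0) := by
    intro c t
    have hd : ∀ t, HasDerivAt (fun t => f (c + t, t))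
        (fderiv ℂ f (c + t, t) (1, 0) + fderiv ℂ f (c + t, t) (0, 1)) t := fun t => by
      have hline : HasDerivAt (fun t : ℂ => (c + t, t)) ((1 : ℂ), (1 : ℂ)) t :=
        ((hasDerivAt_id t).const_add c).prodMk (hasDerivAt_id t)
      refine ((hf _).hasFDerivAt.comp_hasDerivAt t hline).congr_deriv ?_
      rw [← map_add]
      simp
    have := apply_eq_apply_of_omits (f := fun t => f (c + t, t))
      (fun t => (hd t).differentiableAt) (fun t => h0 _)
      (fun t => by rw [(hd t).deriv]; exact h1 _) t 0
    simpa using this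
  obtain ⟨h, hh, hfh⟩ := exists_entire_log (f := fun c => f (c, 0)) (by fun_prop) fun c => h0 _
  refine ⟨h, hh, fun z₁ z₂ => ?_⟩
  rw [← hfh, ← hconst (z₁ - z₂) z₂, sub_add_cancel]
end

section
/- Fix n ≥ 1 and m ≥ 1. For each multi-index I = (i₁, …, iₙ) with 1 ≤ |I| ≤ m let a_I be a polynomial on ℂⁿ, and for entire f : ℂⁿ → ℂ define Df = Σ_{1 ≤ |I| ≤ m} a_I·∂^{|I|}f/∂z₁^{i₁}⋯∂zₙ^{iₙ}. If f : ℂⁿ → ℂ is an entire function with f(z) ≠ 0 for all z ∈ ℂⁿ and Df is a constant C, then C = 0, i.e., Df is identically zero. -/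
/-- Partial derivative in the `j`-th variable of a function on `ℂⁿ`. -/
noncomputable def pderiv' {n : ℕ} (j : Fin n) (f : (Fin n → ℂ) → ℂ) :
    (Fin n → ℂ) → ℂ :=
  fun z => fderiv ℂ f z (Pi.single j 1)

/-- Iterated partial derivative `∂^{|α|}f/∂z₁^{α₁}⋯∂zₙ^{αₙ}` for a multi-index `α`. -/
noncomputable def pderivMulti {n : ℕ} (α : Fin n → ℕ) (f : (Fin n → ℂ) → ℂ) :
    (Fin n → ℂ) → ℂ :=
  (List.finRange n).foldr (fun j g => (pderiv' j)^[α j] g) f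

/-- The linear partial differential operator
`Df = Σ_{1 ≤ |I| ≤ m} a_I · ∂^{|I|}f/∂z₁^{i₁}⋯∂zₙ^{iₙ}` with polynomial
coefficients `a_I`; multi-indices `I` with `1 ≤ |I| ≤ m` are encoded as
functions `Fin n → Fin (m+1)`. -/
noncomputable def Dop {n m : ℕ} (a : (Fin n → Fin (m + 1)) → MvPolynomial (Fin n) ℂ)
    (f : (Fin n → ℂ) → ℂ) : (Fin n → ℂ) → ℂ :=
  fun z => ∑ I ∈ Finset.univ.filter
      (fun I : Fin n → Fin (m + 1) => 1 ≤ ∑ j, (I j : ℕ) ∧ ∑ j, (I j : ℕ) ≤ m),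
    MvPolynomial.eval z (a I) * pderivMulti (fun j => (I j : ℕ)) f z

section
variable {E : Type*} [NormedAddCommGroup E] [NormedSpace ℂ E]

theorem hasDerivAt_comp_line {f : E → ℂ} (hf : Differentiable ℂ f) (z v : E) :
    HasDerivAt (fun t : ℂ => f (z + t • v)) (fderiv ℂ f z v) 0 := by
  have hline : HasDerivAt (fun t : ℂ => z + t • v) v 0 := by
    simpa using ((hasDerivAt_id (0 : ℂ)).smul_const v).const_add z
  have := (hf (z + (0 : ℂ) • v)).hasFDerivAt.comp_hasDerivAt (0 : ℂ) hline
  rw [zero_smul, add_zero] at this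
  exact this

theorem norm_fderiv_apply_le_of_forall_norm_le {f : E → ℂ} (hf : Differentiable ℂ f) {z v : E}
    (hv : ‖v‖ ≤ 1) {M ε : ℝ} (hε : 0 < ε) (hM : ∀ w, ‖w - z‖ ≤ ε → ‖f w‖ ≤ M) :
    ‖fderiv ℂ f z v‖ ≤ M / ε := by
  have hd : Differentiable ℂ (fun t : ℂ => f (z + t • v)) := by fun_prop
  rw [← (hasDerivAt_comp_line hf z v).deriv]
  refine Complex.norm_deriv_le_of_forall_mem_sphere_norm_le hε hd.diffContOnCl fun t ht => hM _ ?_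
  have ht' : ‖t‖ = ε := by simpa using ht
  rw [add_sub_cancel_left, norm_smul, ht']
  exact mul_le_of_le_one_right hε.le hv

theorem fderiv_apply_eq_circleIntegral {f : E → ℂ} (hf : Differentiable ℂ f) (z v : E) :
    fderiv ℂ f z v = (2 * Real.pi * Complex.I : ℂ)⁻¹ •
      ∮ t in C(0, 1), (t ^ 2)⁻¹ • f (z + t • v) := by
  have hd : Differentiable ℂ (fun t : ℂ => f (z + t • v)) := by fun_prop
  have := Complex.two_pi_I_inv_smul_circleIntegral_sub_sq_inv_smul_of_differentiable
    (c := 0) (R := 1) (w₀ := 0) isOpen_univ (Set.subset_univ _) hd.differentiableOn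
    (by simp)
  rw [← (hasDerivAt_comp_line hf z v).deriv, ← this]
  simp

theorem differentiable_fderiv_apply_const [FiniteDimensional ℂ E] {f : E → ℂ}
    (hf : Differentiable ℂ f) (v : E) : Differentiable ℂ (fun z => fderiv ℂ f z v) := by
  intro z₀
  have := FiniteDimensional.proper ℂ E
  borelize E
  obtain ⟨M, hM⟩ := (isCompact_closedBall z₀ (‖v‖ + 2)).exists_bound_of_continuousOn
    hf.continuous.continuousOn
  have hM0 : 0 ≤ M := (norm_nonneg _).trans (hM z₀ (Metric.mem_closedBall_self (by positivity)))
  have hfd : ∀ z ∈ Metric.ball z₀ (‖v‖ + 1), ‖fderiv ℂ f z‖₊ ≤ M.toNNReal := by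
    intro z hz
    rw [← NNReal.coe_le_coe, coe_nnnorm, Real.coe_toNNReal _ hM0]
    refine ContinuousLinearMap.opNorm_le_of_unit_norm hM0 ?_
    intro x hx
    have := norm_fderiv_apply_le_of_forall_norm_le hf (z := z) hx.le one_pos (M := M) fun w hw => by
      apply hM
      rw [Metric.mem_ball, dist_eq_norm] at hz
      rw [Metric.mem_closedBall, dist_eq_norm]
      have := norm_add_le (w - z) (z - z₀)
      rw [sub_add_sub_cancel] at this
      linarith
    simpa using this
  have hlip : LipschitzOnWith M.toNNReal f (Metric.ball z₀ (‖v‖ + 1)) :=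
    (convex_ball _ _).lipschitzOnWith_of_nnnorm_fderiv_le (𝕜 := ℂ) (fun z _ => hf z) hfd
  have hc : Continuous (fun t => circleMap 0 1 t) := continuous_circleMap 0 1
  have hne : ∀ t, circleMap (0 : ℂ) 1 t ≠ 0 := fun t => circleMap_ne_center one_ne_zero
  have hw : Continuous (fun t => deriv (circleMap 0 1) t * ((circleMap 0 1 t) ^ 2)⁻¹) := by
    simp only [deriv_circleMap]
    exact (hc.mul continuous_const).mul ((hc.pow 2).inv₀ fun t => pow_ne_zero _ (hne t))
  have hwn : ∀ t, ‖deriv (circleMap 0 1) t * ((circleMap 0 1 t) ^ 2)⁻¹‖ = 1 := by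
    intro t; simp [deriv_circleMap]
  have hcont : ∀ z : E, Continuous (fun t => (deriv (circleMap 0 1) t * ((circleMap 0 1 t) ^ 2)⁻¹) *
      f (z + circleMap 0 1 t • v)) := fun z =>
    hw.mul (hf.continuous.comp (continuous_const.add (hc.smul continuous_const)))
  have key := intervalIntegral.hasFDerivAt_integral_of_dominated_loc_of_lip (𝕜 := ℂ)
    (μ := MeasureTheory.volume) (a := 0) (b := 2 * Real.pi) (x₀ := z₀) (bound := fun _ => M)
    (F := fun z t => (deriv (circleMap 0 1) t * ((circleMap 0 1 t) ^ 2)⁻¹) *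
      f (z + circleMap 0 1 t • v))
    (F' := fun t => (deriv (circleMap 0 1) t * ((circleMap 0 1 t) ^ 2)⁻¹) •
      fderiv ℂ f (z₀ + circleMap 0 1 t • v))
    (Metric.ball_mem_nhds z₀ one_pos)
    (Filter.Eventually.of_forall fun z => (hcont z).aestronglyMeasurable)
    ((hcont z₀).intervalIntegrable _ _)
    (hw.measurable.smul ((measurable_fderiv ℂ f).comp
      (continuous_const.add (hc.smul continuous_const)).measurable)).aestronglyMeasurable
    (Filter.Eventually.of_forall fun t _ => by
      rw [lipschitzOnWith_iff_norm_sub_le]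
      intro x hx y hy
      have hmem : ∀ x ∈ Metric.ball z₀ 1, x + circleMap 0 1 t • v ∈ Metric.ball z₀ (‖v‖ + 1) := by
        intro x hx
        rw [Metric.mem_ball, dist_eq_norm] at hx ⊢
        have h1 := norm_add_le (x - z₀) (circleMap 0 1 t • v)
        have h2 : ‖circleMap 0 1 t • v‖ = ‖v‖ := by simp [norm_smul]
        rw [show x + circleMap 0 1 t • v - z₀ = x - z₀ + circleMap 0 1 t • v by abel]
        linarith
      have := (lipschitzOnWith_iff_norm_sub_le.1 hlip) (hmem x hx) (hmem y hy)
      rw [← mul_sub, norm_mul, hwn, one_mul]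
      rw [add_sub_add_right_eq_sub] at this
      refine this.trans_eq ?_
      rw [Real.coe_toNNReal _ hM0, Real.coe_nnabs, abs_of_nonneg hM0])
    intervalIntegrable_const
    (Filter.Eventually.of_forall fun t _ => by
      have h1 : HasFDerivAt (fun x : E => x + circleMap 0 1 t • v) (ContinuousLinearMap.id ℂ E) z₀ :=
        (hasFDerivAt_id z₀).add_const _
      have h2 := (hf (z₀ + circleMap 0 1 t • v)).hasFDerivAt.comp z₀ h1
      simpa using h2.const_mul (deriv (circleMap 0 1) t * ((circleMap 0 1 t) ^ 2)⁻¹))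
  have heq : (fun z => fderiv ℂ f z v) = fun z => (2 * Real.pi * Complex.I : ℂ)⁻¹ •
      ∫ t in (0 : ℝ)..2 * Real.pi, (deriv (circleMap 0 1) t * ((circleMap 0 1 t) ^ 2)⁻¹) *
        f (z + circleMap 0 1 t • v) := by
    funext z
    rw [fderiv_apply_eq_circleIntegral hf, circleIntegral]
    simp only [smul_eq_mul, mul_assoc]
  rw [heq]
  exact key.2.differentiableAt.const_smul (2 * Real.pi * Complex.I : ℂ)⁻¹

/-- Borel–Carathéodory control of the modulus of a zero-free entire function. -/
theorem abs_log_norm_sub_le_of_forall_ne_zero {φ : ℂ → ℂ} (hφ : Differentiable ℂ φ)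
    (hne : ∀ t, φ t ≠ 0) {B R : ℝ} (hB : 0 < B)
    (hbd : ∀ t, ‖t‖ < R → Real.log ‖φ 0‖ - Real.log ‖φ t‖ ≤ B) {t : ℂ} (ht : ‖t‖ < R) :
    |Real.log ‖φ t‖ - Real.log ‖φ 0‖| ≤ 2 * B * ‖t‖ / (R - ‖t‖) := by
  have hR : 0 < R := (norm_nonneg t).trans_lt ht
  have hd : Differentiable ℂ (fun t => deriv φ t / φ t) := hφ.deriv.div hφ hne
  obtain ⟨G, hG0, hG⟩ := (DifferentiableOn.isExactOn_ball
    (hd.differentiableOn (s := Metric.ball 0 R))).with_val_at 0 0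
  have hexp : ∀ s ∈ Metric.ball (0 : ℂ) R, φ s = φ 0 * Complex.exp (G s) := by
    have hder : ∀ s ∈ Metric.ball (0 : ℂ) R,
        HasDerivAt (fun s => φ s * Complex.exp (-G s)) 0 s := by
      intro s hs
      have h1 := (hφ s).hasDerivAt.mul (hG s hs).neg.cexp
      have h2 : deriv φ s * Complex.exp ((-G) s) +
          φ s * (Complex.exp ((-G) s) * -(deriv φ s / φ s)) = 0 := by
        have := hne s
        field_simp
        ring
      rw [h2] at h1
      exact h1
    intro s hs
    have := (convex_ball (0 : ℂ) R).is_const_of_fderivWithin_eq_zero (𝕜 := ℂ)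
      (f := fun s => φ s * Complex.exp (-G s))
      (fun x hx => (hder x hx).differentiableAt.differentiableWithinAt)
      (fun x hx => by
        rw [fderivWithin_of_isOpen Metric.isOpen_ball hx]
        have := (hder x hx).hasFDerivAt.fderiv
        rw [this]; ext; simp) hs (Metric.mem_ball_self hR)
    simp only [hG0, neg_zero, Complex.exp_zero, mul_one] at this
    rw [← this, mul_assoc, ← Complex.exp_add, neg_add_cancel, Complex.exp_zero, mul_one]
  have hlog : ∀ s ∈ Metric.ball (0 : ℂ) R, Real.log ‖φ s‖ - Real.log ‖φ 0‖ = (G s).re := by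
    intro s hs
    rw [hexp s hs, norm_mul, Complex.norm_exp, Real.log_mul (by simpa using hne 0)
      (Real.exp_ne_zero _), Real.log_exp]
    ring
  have htm : t ∈ Metric.ball (0 : ℂ) R := by simpa using ht
  rw [hlog t htm]
  have hGd : DifferentiableOn ℂ (fun s => -G s) (Metric.ball 0 R) := fun s hs =>
    (hG s hs).neg.differentiableAt.differentiableWithinAt
  have := Complex.borelCaratheodory_zero hB hGd (fun s hs => by
    have h1 := hbd s (by simpa using hs)
    have h2 := hlog s hs
    simp only [Set.mem_ofPred_eq, Complex.neg_re]
    linarith) hR htm (by simp [hG0])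
  rw [norm_neg] at this
  exact (Complex.abs_re_le_norm _).trans this

/-- The same control along the complex line joining two points. -/
theorem abs_log_norm_sub_le_of_forall_mem_ball {f : E → ℂ} (hf : Differentiable ℂ f)
    (hne : ∀ z, f z ≠ 0) {z w : E} {B δ : ℝ} (hB : 0 < B)
    (hbd : ∀ x, ‖x - z‖ < δ → Real.log ‖f z‖ - Real.log ‖f x‖ ≤ B) (hw : ‖w - z‖ < δ) :
    |Real.log ‖f w‖ - Real.log ‖f z‖| ≤ 2 * B * ‖w - z‖ / (δ - ‖w - z‖) := by
  rcases eq_or_ne w z with rfl | hwz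
  · simp
  have hpos : 0 < ‖w - z‖ := norm_pos_iff.2 (sub_ne_zero.2 hwz)
  have := abs_log_norm_sub_le_of_forall_ne_zero (φ := fun t : ℂ => f (z + t • (w - z)))
    (by fun_prop) (fun t => hne _) hB (R := δ / ‖w - z‖) (fun t ht => by
      have := hbd (z + t • (w - z)) (by
        rw [add_sub_cancel_left, norm_smul]
        exact (lt_div_iff₀ hpos).1 ht)
      simpa using this) (t := 1) (by simpa using (one_lt_div hpos).2 hw)
  simp only [one_smul, add_sub_cancel, zero_smul, add_zero, norm_one, mul_one] at this
  refine this.trans_eq ?_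
  have : δ - ‖w - z‖ ≠ 0 := (sub_pos.2 hw).ne'
  have h2 : δ / ‖w - z‖ - 1 = (δ - ‖w - z‖) / ‖w - z‖ := by field_simp
  rw [h2]
  field_simp

end
section
variable {n : ℕ}

/-- `g` obeys the Cauchy estimates of a `k`-th order derivative of `f`. -/
def IsCauchyBounded (f : (Fin n → ℂ) → ℂ) (k : ℕ) (g : (Fin n → ℂ) → ℂ) : Prop :=
  Differentiable ℂ g ∧ ∀ (z : Fin n → ℂ) (M ε : ℝ), 0 < ε →
    (∀ w, ‖w - z‖ ≤ k * ε → ‖f w‖ ≤ M) → ‖g z‖ ≤ M / ε ^ k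

theorem IsCauchyBounded.pderiv' {f g : (Fin n → ℂ) → ℂ} {k : ℕ} (hg : IsCauchyBounded f k g)
    (j : Fin n) : IsCauchyBounded f (k + 1) (pderiv' j g) := by
  refine ⟨differentiable_fderiv_apply_const hg.1 _, fun z M ε hε hM => ?_⟩
  have hv : ‖(Pi.single j 1 : Fin n → ℂ)‖ ≤ 1 := by
    rw [pi_norm_le_iff_of_nonneg zero_le_one]
    intro i
    rcases eq_or_ne i j with rfl | hij
    · simp
    · simp [hij]
  rw [pow_succ, ← div_div]
  refine norm_fderiv_apply_le_of_forall_norm_le hg.1 hv hε fun w hw =>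
    hg.2 w M ε hε fun x hx => hM x ?_
  have := norm_add_le (x - w) (w - z)
  rw [sub_add_sub_cancel] at this
  push_cast
  linarith

theorem IsCauchyBounded.iterate_pderiv' {f g : (Fin n → ℂ) → ℂ} {k : ℕ}
    (hg : IsCauchyBounded f k g) (j : Fin n) (i : ℕ) :
    IsCauchyBounded f (k + i) ((_root_.pderiv' j)^[i] g) := by
  induction i with
  | zero => exact hg
  | succ i ih =>
    rw [Function.iterate_succ_apply']
    exact ih.pderiv' j

theorem isCauchyBounded_pderivMulti {f : (Fin n → ℂ) → ℂ} (hf : Differentiable ℂ f)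
    (α : Fin n → ℕ) : IsCauchyBounded f (∑ j, α j) (pderivMulti α f) := by
  have key : ∀ l : List (Fin n), IsCauchyBounded f (l.map α).sum
      (l.foldr (fun j g => (pderiv' j)^[α j] g) f) := by
    intro l
    induction l with
    | nil => exact ⟨hf, fun z M ε hε hM => by
        have := hM z (by simp)
        simpa using this⟩
    | cons j l ih =>
      rw [List.map_cons, List.sum_cons, List.foldr_cons, add_comm]
      exact ih.iterate_pderiv' j (α j)
  have := key (List.finRange n)
  rwa [← List.ofFn_eq_map, List.sum_ofFn] at this

theorem MvPolynomial.exists_norm_eval_le (p : MvPolynomial (Fin n) ℂ) :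
    ∃ K : ℝ, ∃ d : ℕ, 0 ≤ K ∧ ∀ z, ‖MvPolynomial.eval z p‖ ≤ K * (1 + ‖z‖) ^ d := by
  induction p using MvPolynomial.induction_on with
  | C a => exact ⟨‖a‖, 0, norm_nonneg a, fun z => by simp⟩
  | add p q hp hq =>
    obtain ⟨K, d, hK, hp⟩ := hp
    obtain ⟨L, e, hL, hq⟩ := hq
    refine ⟨K + L, max d e, by positivity, fun z => ?_⟩
    have h1 : 1 ≤ 1 + ‖z‖ := le_add_of_nonneg_right (norm_nonneg z)
    rw [map_add, add_mul]
    refine (norm_add_le _ _).trans (add_le_add ((hp z).trans ?_) ((hq z).trans ?_))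
    · gcongr
      exact le_max_left _ _
    · gcongr
      exact le_max_right _ _
  | mul_X p j hp =>
    obtain ⟨K, d, hK, hp⟩ := hp
    refine ⟨K, d + 1, hK, fun z => ?_⟩
    rw [map_mul, MvPolynomial.eval_X, norm_mul, pow_succ, ← mul_assoc]
    gcongr
    · exact hp z
    · exact (norm_le_pi_norm z j).trans (le_add_of_nonneg_left zero_le_one)

theorem MvPolynomial.exists_sum_norm_eval_le {ι : Type*} (s : Finset ι)
    (p : ι → MvPolynomial (Fin n) ℂ) :
    ∃ K : ℝ, ∃ d : ℕ, 0 ≤ K ∧ ∀ z, ∑ i ∈ s, ‖MvPolynomial.eval z (p i)‖ ≤ K * (1 + ‖z‖) ^ d := by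
  choose K d hK h using fun i => (p i).exists_norm_eval_le
  refine ⟨∑ i ∈ s, K i, s.sup d, Finset.sum_nonneg fun i _ => hK i, fun z => ?_⟩
  rw [Finset.sum_mul]
  refine Finset.sum_le_sum fun i hi => (h i z).trans ?_
  have h1 : 1 ≤ 1 + ‖z‖ := le_add_of_nonneg_right (norm_nonneg z)
  have := hK i
  gcongr
  exact Finset.le_sup hi

end

/-- A bounded nonnegative sequence whose terms are controlled by the logarithm of the next one
has first term controlled by the additive error. -/
theorem le_of_forall_le_add_log {a : ℕ → ℝ} {N L M : ℝ} (hN : 1 ≤ N) (hL : 1 ≤ L)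
    (ha : ∀ k, 0 ≤ a k) (hM : ∀ k, a k ≤ M)
    (h : ∀ k : ℕ, a k ≤ L + N * k + N * Real.log (1 + a (k + 1))) :
    a 0 ≤ (1 + 8 * N ^ 2) * L := by
  by_contra! h0
  have key : ∀ k : ℕ, L + N * k + 8 * N ^ 2 * (L + k) < a k := by
    intro k
    induction k with
    | zero => push_cast; linarith
    | succ k ih =>
      set x : ℝ := L + k with hx
      have hx1 : 1 ≤ x := by have : (0 : ℝ) ≤ k := k.cast_nonneg; linarith
      have h1 : N * (8 * N * x) < N * Real.log (1 + a (k + 1)) := by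
        have := h k
        nlinarith
      have h2 : 8 * N * x < Real.log (1 + a (k + 1)) := lt_of_mul_lt_mul_left h1 (by linarith)
      have h3 : Real.exp (8 * N * x) < 1 + a (k + 1) :=
        (Real.lt_log_iff_exp_lt (by have := ha (k + 1); linarith)).1 h2
      have h4 := Real.quadratic_le_exp_of_nonneg (x := 8 * N * x) (by positivity)
      have h5 : 32 * N ^ 2 * x ≤ 32 * N ^ 2 * x ^ 2 := by
        have : x ≤ x ^ 2 := by nlinarith
        gcongr
      have h6 : N * x ≤ N ^ 2 * x := by
        have : N ≤ N ^ 2 := by nlinarith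
        gcongr
      have h7 : N ^ 2 ≤ N ^ 2 * x := le_mul_of_one_le_right (by positivity) hx1
      have h8 : N ≤ N * x := le_mul_of_one_le_right (by positivity) hx1
      have h9 : x ≤ N * x := le_mul_of_one_le_left (by positivity) hN
      have h10 : N * k ≤ N * x := by gcongr; linarith
      have h11 : (0 : ℝ) ≤ k := k.cast_nonneg
      push_cast
      have h12 : L + (k + 1 : ℝ) = x + 1 := by rw [hx]; ring
      rw [h12]
      nlinarith
  obtain ⟨k, hk⟩ := exists_nat_gt M
  have h1 := key k
  have h2 := hM k
  have h3 : (0 : ℝ) ≤ k := k.cast_nonneg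
  nlinarith [sq_nonneg N]

section
variable {n m : ℕ} {f : (Fin n → ℂ) → ℂ}

theorem norm_pderivMulti_le_of_log_le (hf : Differentiable ℂ f) (h0 : ∀ z, f z ≠ 0)
    (hm : 1 ≤ m) {z : Fin n → ℂ} {B δ : ℝ} (hB : 0 < B) (hδ : 0 < δ)
    (hbd : ∀ x, ‖x - z‖ < δ → Real.log ‖f z‖ - Real.log ‖f x‖ ≤ B)
    (α : Fin n → ℕ) (hα : ∑ j, α j ≤ m) :
    ‖pderivMulti α f z‖ ≤ ‖f z‖ * Real.exp 1 * (m * (1 + 2 * B) / δ) ^ (∑ j, α j) := by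
  have hm' : (1 : ℝ) ≤ m := by exact_mod_cast hm
  have hS : 0 < m * (1 + 2 * B) / δ := by positivity
  have := (isCauchyBounded_pderivMulti hf α).2 z (‖f z‖ * Real.exp 1) (m * (1 + 2 * B) / δ)⁻¹
    (inv_pos.2 hS) fun w hw => by
      have hw1 : ‖w - z‖ * (1 + 2 * B) ≤ δ := by
        have h1 : ((∑ j, α j : ℕ) : ℝ) ≤ m := by exact_mod_cast hα
        have h2 : ‖w - z‖ ≤ m * (m * (1 + 2 * B) / δ)⁻¹ := hw.trans (by gcongr)
        have h3 : m * (m * (1 + 2 * B) / δ)⁻¹ = δ / (1 + 2 * B) := by field_simp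
        rw [h3] at h2
        exact (le_div_iff₀ (by positivity)).1 h2
      have hw2 : ‖w - z‖ < δ := by
        rcases (norm_nonneg (w - z)).eq_or_lt with h | h
        · rwa [← h]
        · nlinarith
      have h1 := abs_log_norm_sub_le_of_forall_mem_ball hf h0 hB hbd hw2
      have h2 : 2 * B * ‖w - z‖ / (δ - ‖w - z‖) ≤ 1 := by
        rw [div_le_one (sub_pos.2 hw2)]
        linarith
      have h3 : Real.log ‖f w‖ ≤ Real.log ‖f z‖ + 1 := by
        linarith [(abs_le.1 (h1.trans h2)).2]
      have h4 := Real.exp_le_exp.2 h3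
      rwa [Real.exp_add, Real.exp_log (norm_pos_iff.2 (h0 w)),
        Real.exp_log (norm_pos_iff.2 (h0 z))] at h4
  rwa [inv_pow, div_inv_eq_mul] at this

theorem norm_Dop_le_of_log_le (hf : Differentiable ℂ f) (h0 : ∀ z, f z ≠ 0)
    (hm : 1 ≤ m) (a : (Fin n → Fin (m + 1)) → MvPolynomial (Fin n) ℂ)
    {z : Fin n → ℂ} {B δ : ℝ} (hB : 0 < B) (hδ : 0 < δ)
    (hbd : ∀ x, ‖x - z‖ < δ → Real.log ‖f z‖ - Real.log ‖f x‖ ≤ B) :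
    ‖Dop a f z‖ ≤ (∑ I ∈ Finset.univ.filter
      (fun I : Fin n → Fin (m + 1) => 1 ≤ ∑ j, (I j : ℕ) ∧ ∑ j, (I j : ℕ) ≤ m),
        ‖MvPolynomial.eval z (a I)‖) * (‖f z‖ * Real.exp 1 *
          (m * (1 + 2 * B) / δ * (1 + m * (1 + 2 * B) / δ) ^ m)) := by
  rw [Dop, Finset.sum_mul]
  refine (norm_sum_le _ _).trans (Finset.sum_le_sum fun I hI => ?_)
  obtain ⟨hI1, hI2⟩ := (Finset.mem_filter.1 hI).2
  rw [norm_mul]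
  refine mul_le_mul_of_nonneg_left ((norm_pderivMulti_le_of_log_le hf h0 hm hB hδ hbd
    (fun j => (I j : ℕ)) hI2).trans ?_) (norm_nonneg _)
  refine mul_le_mul_of_nonneg_left ?_ (by positivity)
  set S : ℝ := m * (1 + 2 * B) / δ with hS
  have hS0 : 0 ≤ S := by positivity
  obtain ⟨k, hk⟩ := Nat.exists_eq_add_of_le' hI1
  rw [hk, pow_succ']
  refine mul_le_mul_of_nonneg_left ?_ hS0
  calc S ^ k ≤ (1 + S) ^ k := by gcongr; linarith
    _ ≤ (1 + S) ^ m := pow_le_pow_right₀ (by linarith) (by omega)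

theorem exists_exp_log_le_of_Dop_eq_const (hf : Differentiable ℂ f) (h0 : ∀ z, f z ≠ 0)
    (hm : 1 ≤ m) (a : (Fin n → Fin (m + 1)) → MvPolynomial (Fin n) ℂ)
    {C : ℂ} (hC : ∀ z, Dop a f z = C) (hC0 : C ≠ 0) :
    ∃ K : ℝ, ∃ d : ℕ, 1 ≤ K ∧ ∀ (r δ B : ℝ), 0 < δ → 0 < B →
      (∀ x, ‖x‖ ≤ r + δ → Real.log ‖f 0‖ - Real.log ‖f x‖ ≤ B) →
      ∀ z, ‖z‖ ≤ r → 0 ≤ Real.log ‖f 0‖ - Real.log ‖f z‖ →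
      Real.exp (Real.log ‖f 0‖ - Real.log ‖f z‖) ≤ K * (1 + r) ^ d *
        (m * (1 + 2 * B) / δ * (1 + m * (1 + 2 * B) / δ) ^ m) := by
  obtain ⟨K, d, hK, hKd⟩ := MvPolynomial.exists_sum_norm_eval_le (Finset.univ.filter
      (fun I : Fin n → Fin (m + 1) => 1 ≤ ∑ j, (I j : ℕ) ∧ ∑ j, (I j : ℕ) ≤ m)) a
  refine ⟨K * Real.exp 1 * ‖f 0‖ / ‖C‖ + 1, d, le_add_of_nonneg_left (by positivity), ?_⟩
  intro r δ B hδ hB hbd z hz hu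
  have hr : 0 ≤ r := (norm_nonneg z).trans hz
  have h1 := norm_Dop_le_of_log_le hf h0 hm a hB hδ (z := z) fun x hx => by
    have := norm_add_le (x - z) z
    rw [sub_add_cancel] at this
    linarith [hbd x (by linarith)]
  rw [hC z] at h1
  set T : ℝ := m * (1 + 2 * B) / δ * (1 + m * (1 + 2 * B) / δ) ^ m
  have hT : 0 ≤ T := by positivity
  have hCpos : 0 < ‖C‖ := norm_pos_iff.2 hC0
  have hfz : 0 < ‖f z‖ := norm_pos_iff.2 (h0 z)
  have h2 : ‖C‖ ≤ K * (1 + r) ^ d * (‖f z‖ * Real.exp 1 * T) :=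
    h1.trans (mul_le_mul_of_nonneg_right ((hKd z).trans (by gcongr)) (by positivity))
  rw [Real.exp_sub, Real.exp_log (norm_pos_iff.2 (h0 0)), Real.exp_log hfz]
  calc ‖f 0‖ / ‖f z‖ = ‖f 0‖ / (‖f z‖ * ‖C‖) * ‖C‖ := by field_simp
    _ ≤ ‖f 0‖ / (‖f z‖ * ‖C‖) * (K * (1 + r) ^ d * (‖f z‖ * Real.exp 1 * T)) := by gcongr
    _ = K * Real.exp 1 * ‖f 0‖ / ‖C‖ * (1 + r) ^ d * T := by field_simp
    _ ≤ (K * Real.exp 1 * ‖f 0‖ / ‖C‖ + 1) * (1 + r) ^ d * T := by gcongr; linarith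

/-- A function with logarithmic growth at most logarithmic attains the maximum of `-log ‖f‖`
at the origin. -/
theorem log_norm_sub_nonpos_of_log_growth (hf : Differentiable ℂ f) (h0 : ∀ z, f z ≠ 0)
    {c₁ c₂ : ℝ} (hc₁ : 0 < c₁) (hc₂ : 0 ≤ c₂)
    (h : ∀ z, Real.log ‖f 0‖ - Real.log ‖f z‖ ≤ c₁ + c₂ * Real.log (2 + ‖z‖)) (z : Fin n → ℂ) :
    Real.log ‖f 0‖ - Real.log ‖f z‖ ≤ 0 := by
  by_contra! hpos
  set a := Real.log ‖f 0‖ - Real.log ‖f z‖ with ha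
  set r := ‖z‖ with hr
  have hr0 : 0 ≤ r := norm_nonneg z
  set P := a * (2 + r) + 2 * r * c₁ + 4 * r * c₂ with hP
  have hP0 : 0 < P := by positivity
  set x := P / a + (2 + r) with hx
  have hx2 : 2 + r ≤ x := le_add_of_nonneg_left (by positivity)
  have hax : a * x = P + a * (2 + r) := by rw [hx]; field_simp
  have hRr : r < x ^ 2 - 2 := by nlinarith
  have key := abs_log_norm_sub_le_of_forall_mem_ball hf h0 (z := 0) (w := z) (B := c₁ + c₂ * (2 * x))
    (δ := x ^ 2 - 2) (by positivity) (fun y hy => by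
      rw [sub_zero] at hy
      refine (h y).trans ?_
      have h1 : Real.log (2 + ‖y‖) ≤ Real.log (x ^ 2) :=
        Real.log_le_log (by positivity) (by linarith)
      have h2 : Real.log (x ^ 2) = 2 * Real.log x := by rw [Real.log_pow]; norm_num
      have h3 := Real.log_le_self (show 0 ≤ x by linarith)
      gcongr
      linarith) (by rwa [sub_zero])
  rw [sub_zero, le_div_iff₀ (sub_pos.2 hRr)] at key
  have h1 : a ≤ |Real.log ‖f z‖ - Real.log ‖f 0‖| := by
    rw [ha, abs_sub_comm]; exact le_abs_self _
  have h2 : a * (x ^ 2 - 2 - r) ≤ 2 * (c₁ + c₂ * (2 * x)) * r :=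
    (mul_le_mul_of_nonneg_right h1 (sub_pos.2 hRr).le).trans key
  have h3 : a * x ^ 2 = P * x + a * (2 + r) * x := by rw [pow_two, ← mul_assoc, hax]; ring
  have h4 : 0 < a * (2 + r) * x := by positivity
  have h5 : 0 ≤ (a * (2 + r) + 2 * r * c₁) * (x - 1) :=
    mul_nonneg (by positivity) (by linarith)
  nlinarith

theorem exists_log_growth_of_Dop_eq_const (hf : Differentiable ℂ f) (h0 : ∀ z, f z ≠ 0)
    (hm : 1 ≤ m) (a : (Fin n → Fin (m + 1)) → MvPolynomial (Fin n) ℂ)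
    {C : ℂ} (hC : ∀ z, Dop a f z = C) (hC0 : C ≠ 0) :
    ∃ c₁ c₂ : ℝ, 0 < c₁ ∧ 0 ≤ c₂ ∧
      ∀ z, Real.log ‖f 0‖ - Real.log ‖f z‖ ≤ c₁ + c₂ * Real.log (2 + ‖z‖) := by
  obtain ⟨K, d, hK, hgrowth⟩ := exists_exp_log_le_of_Dop_eq_const hf h0 hm a hC hC0
  set u : (Fin n → ℂ) → ℝ := fun z => Real.log ‖f 0‖ - Real.log ‖f z‖ with hu
  have hu0 : u 0 = 0 := sub_self _
  have hucont : Continuous u :=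
    continuous_const.sub (hf.continuous.norm.log fun z => norm_ne_zero_iff.2 (h0 z))
  have hmax : ∀ r : ℝ, 0 ≤ r → ∃ z, ‖z‖ ≤ r ∧ ∀ x, ‖x‖ ≤ r → u x ≤ u z := by
    intro r hr
    obtain ⟨z, hz, hzm⟩ := (isCompact_closedBall (0 : Fin n → ℂ) r).exists_isMaxOn
      ⟨0, Metric.mem_closedBall_self hr⟩ hucont.continuousOn
    exact ⟨z, by simpa using hz, fun x hx => hzm (by simpa using hx)⟩
  choose! p hp hpm using hmax
  have hm' : (1 : ℝ) ≤ m := by exact_mod_cast hm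
  set N : ℝ := m + 1 with hN
  have hlog8 : 0 ≤ Real.log (8 * m) := Real.log_nonneg (by linarith)
  have hlogK : 0 ≤ Real.log K := Real.log_nonneg hK
  refine ⟨(1 + 8 * N ^ 2) * (1 + Real.log K + N * Real.log (8 * m)), (1 + 8 * N ^ 2) * d,
    by positivity, by positivity, fun w => ?_⟩
  set r₀ := ‖w‖ with hr₀
  have hr₀0 : 0 ≤ r₀ := norm_nonneg w
  have hlogr : 0 ≤ Real.log (2 + r₀) := Real.log_nonneg (by linarith)
  set r : ℕ → ℝ := fun k => r₀ + 1 - (1 / 2) ^ k with hr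
  have hr0 : ∀ k, 0 ≤ r k := fun k => by
    have : (1 / 2 : ℝ) ^ k ≤ 1 := pow_le_one₀ (by norm_num) (by norm_num)
    simp only [hr]; linarith
  have hr1 : ∀ k, r k ≤ r₀ + 1 := fun k => by
    have : (0 : ℝ) ≤ (1 / 2 : ℝ) ^ k := by positivity
    simp only [hr]; linarith
  have hrs : ∀ k, r k + (1 / 2) ^ (k + 1) = r (k + 1) := fun k => by
    simp only [hr, pow_succ]; ring
  have hnonneg : ∀ k, 0 ≤ u (p (r k)) := fun k => by
    have := hpm (r k) (hr0 k) 0 (by simpa using hr0 k)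
    rwa [hu0] at this
  have hrec : ∀ k : ℕ, u (p (r k)) ≤ (1 + Real.log K + d * Real.log (2 + r₀) +
      N * Real.log (8 * m)) + N * k + N * Real.log (1 + u (p (r (k + 1)))) := by
    intro k
    set A := u (p (r (k + 1))) with hA
    have hA0 : 0 ≤ A := hnonneg (k + 1)
    have h1 := hgrowth (r k) ((1 / 2) ^ (k + 1)) (1 + A) (by positivity) (by positivity)
      (fun x hx => by
        rw [hrs] at hx
        exact (hpm _ (hr0 (k + 1)) x hx).trans (by linarith))
      (p (r k)) (hp _ (hr0 k)) (hnonneg k)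
    set S : ℝ := m * (1 + 2 * (1 + A)) / (1 / 2) ^ (k + 1) with hS
    have hS0 : 0 ≤ S := by positivity
    have hS1 : 1 + S ≤ 8 * m * 2 ^ k * (1 + A) := by
      have h2 : S = 2 * (m * 2 ^ k) * (3 + 2 * A) := by
        rw [hS, one_div, inv_pow, div_inv_eq_mul, pow_succ]; ring
      have h3 : (1 : ℝ) ≤ m * 2 ^ k := one_le_mul_of_one_le_of_one_le hm'
        (one_le_pow₀ (by norm_num))
      rw [h2]
      nlinarith
    have h2 : S * (1 + S) ^ m ≤ (8 * m * 2 ^ k * (1 + A)) ^ (m + 1) := by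
      calc S * (1 + S) ^ m ≤ (1 + S) * (1 + S) ^ m := by gcongr; linarith
        _ = (1 + S) ^ (m + 1) := (pow_succ' _ _).symm
        _ ≤ _ := by gcongr
    have h3 : Real.exp (u (p (r k))) ≤
        K * (2 + r₀) ^ d * (8 * m * 2 ^ k * (1 + A)) ^ (m + 1) := by
      refine h1.trans (mul_le_mul ?_ h2 (by positivity) (by positivity))
      have := hr0 k
      have : 1 + r k ≤ 2 + r₀ := by linarith [hr1 k]
      gcongr
    have h4 := (Real.le_log_iff_exp_le (by positivity)).2 h3
    rw [Real.log_mul (by positivity) (by positivity), Real.log_mul (by positivity) (by positivity),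
      Real.log_pow, Real.log_pow, Real.log_mul (by positivity) (by positivity),
      Real.log_mul (by positivity) (by positivity), Real.log_pow] at h4
    have h5 : (k : ℝ) * Real.log 2 ≤ k :=
      mul_le_of_le_one_right k.cast_nonneg (by linarith [Real.log_two_lt_d9])
    have h6 : N * (k * Real.log 2) ≤ N * k := by gcongr
    push_cast at h4
    rw [← hN] at h4
    linarith
  have hr00 : r 0 = r₀ := by simp [hr]
  have hbound := le_of_forall_le_add_log (N := N) (M := u (p (r₀ + 1)))
    (by linarith) (by
      have : 0 ≤ d * Real.log (2 + r₀) + N * Real.log (8 * m) := by positivity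
      linarith) hnonneg
    (fun k => hpm _ (by positivity) _ ((hp _ (hr0 k)).trans (hr1 k))) hrec
  rw [hr00] at hbound
  refine (hpm r₀ hr₀0 w le_rfl).trans (hbound.trans_eq ?_)
  ring

end

/-- Final claim in the proof of Corollary 4: if `f` is entire on `ℂⁿ`, omits `0`, and
`Df` is a constant `C` (where `D` is a linear partial differential operator with
polynomial coefficients and no zeroth-order term), then `C = 0`. -/
theorem Dop_const_eq_zero (n m : ℕ) (hn : 1 ≤ n) (hm : 1 ≤ m)
    (aI : (Fin n → Fin (m + 1)) → MvPolynomial (Fin n) ℂ)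
    (f : (Fin n → ℂ) → ℂ) (hf : Differentiable ℂ f)
    (h0 : ∀ z : Fin n → ℂ, f z ≠ 0)
    (C : ℂ) (hC : ∀ z : Fin n → ℂ, Dop aI f z = C) :
    C = 0 := by
  by_contra hC0
  obtain ⟨c₁, c₂, hc₁, hc₂, hlog⟩ := exists_log_growth_of_Dop_eq_const hf h0 hm aI hC hC0
  have hu := log_norm_sub_nonpos_of_log_growth hf h0 hc₁ hc₂ hlog
  obtain ⟨K, d, hK, hgrowth⟩ := exists_exp_log_le_of_Dop_eq_const hf h0 hm aI hC hC0
  have hm' : (1 : ℝ) ≤ m := by exact_mod_cast hm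
  set s : ℝ := (1 + K * 2 ^ m)⁻¹ with hs
  have hs0 : 0 < s := by positivity
  have hs1 : s ≤ 1 := inv_le_one_of_one_le₀ (le_add_of_nonneg_right (by positivity))
  have h1 := hgrowth 0 (3 * m / s) 1 (by positivity) one_pos
    (fun x _ => (hu x).trans zero_le_one) 0 (by simp) (by simp)
  have h2 : m * (1 + 2 * 1) / (3 * m / s) = s := by field_simp; norm_num
  rw [h2, sub_self, Real.exp_zero, add_zero, one_pow, mul_one] at h1
  have h3 : K * (s * (1 + s) ^ m) ≤ K * (s * 2 ^ m) := by gcongr; linarith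
  have h4 : s * (1 + K * 2 ^ m) = 1 := inv_mul_cancel₀ (by positivity)
  nlinarith
end
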